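/- Let F = F(x^1,…,x^N) satisfy the commutativity equations F_i F_j = F_j F_i for all i,j. Fix i₀ and suppose the (N−1)×N matrix P = (F_{i₀ i j}) (rows indexed by i ≠ i₀, columns by j = 1,…,N) has rank N−1 at a point. Define A^k = (−1)^{k+1} det P_k, where P_k is P with its k-th column removed, and let B be the N×N matrix with entries B_{ij} = Σ_{k=1}^N A^k F_{kij}. Then B is diagonal: B_{rt} = 0 for all r ≠ t. -/

import Mathlib

open scoped BigOperators

noncomputable def pd {N : ℕ} (i : Fin N) (f : (Fin N → ℂ) → ℂ) : (Fin N → ℂ) → ℂ :=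
  fun x => fderiv ℂ f x (Pi.single i 1)

noncomputable def D3 {N : ℕ} (F : (Fin N → ℂ) → ℂ) (i p q : Fin N) (x : Fin N → ℂ) : ℂ :=
  pd i (pd p (pd q F)) x

noncomputable def Fmat {N : ℕ} (F : (Fin N → ℂ) → ℂ) (i : Fin N) (x : Fin N → ℂ) :
    Matrix (Fin N) (Fin N) ℂ :=
  Matrix.of fun p q => D3 F i p q x

/-- The `(N−1)×N` matrix `P = (F_{i₀ i j})` with rows indexed by `i ≠ i₀`
(in increasing order) and columns by `j = 1,…,N`. -/
noncomputable def Pmat {n : ℕ} (F : (Fin (n + 1) → ℂ) → ℂ) (i₀ : Fin (n + 1))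
    (x : Fin (n + 1) → ℂ) : Matrix (Fin n) (Fin (n + 1)) ℂ :=
  Matrix.of fun i j => D3 F i₀ (i₀.succAbove i) j x

/-- `A^k = (−1)^{k+1} det P_k` (with the 1-based sign convention of the paper,
so `(−1)^{k}` for the 0-based index `k`), where `P_k` is `P` with the `k`-th
column removed. -/
noncomputable def Acoef {n : ℕ} (F : (Fin (n + 1) → ℂ) → ℂ) (i₀ : Fin (n + 1))
    (x : Fin (n + 1) → ℂ) (k : Fin (n + 1)) : ℂ :=
  (-1 : ℂ) ^ (k : ℕ) *
    (Matrix.of fun i j : Fin n => Pmat F i₀ x i (k.succAbove j)).det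

/-- The matrix `B` with entries `B_{ij} = Σ_k A^k F_{kij}`. -/
noncomputable def Bmat {n : ℕ} (F : (Fin (n + 1) → ℂ) → ℂ) (i₀ : Fin (n + 1))
    (x : Fin (n + 1) → ℂ) : Matrix (Fin (n + 1)) (Fin (n + 1)) ℂ :=
  Matrix.of fun i j => ∑ k, Acoef F i₀ x k * D3 F k i j x

theorem contDiff_pd {N : ℕ} {f : (Fin N → ℂ) → ℂ} (hf : ContDiff ℂ ⊤ f) (i : Fin N) :
    ContDiff ℂ ⊤ (pd i f) :=
  (hf.fderiv_right le_top).clm_apply contDiff_const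

theorem pd_pd_eq_fderiv {N : ℕ} {f : (Fin N → ℂ) → ℂ} (hf : ContDiff ℂ ⊤ f) (i j : Fin N)
    (x : Fin N → ℂ) :
    pd i (pd j f) x = fderiv ℂ (fderiv ℂ f) x (Pi.single i 1) (Pi.single j 1) := by
  have hd : DifferentiableAt ℂ (fderiv ℂ f) x :=
    (hf.fderiv_right (m := ⊤) le_top).differentiable (by simp) x
  unfold pd
  rw [fderiv_clm_apply hd (differentiableAt_const _)]
  simp

theorem pd_comm {N : ℕ} {f : (Fin N → ℂ) → ℂ} (hf : ContDiff ℂ ⊤ f) (i j : Fin N) :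
    pd i (pd j f) = pd j (pd i f) := by
  ext x
  rw [pd_pd_eq_fderiv hf, pd_pd_eq_fderiv hf]
  exact hf.contDiffAt.isSymmSndFDerivAt (by simp) _ _

theorem D3_swap_left {N : ℕ} {F : (Fin N → ℂ) → ℂ} (hF : ContDiff ℂ ⊤ F) (i p q : Fin N)
    (x : Fin N → ℂ) : D3 F i p q x = D3 F p i q x := by
  unfold D3
  rw [pd_comm (contDiff_pd hF q)]

theorem D3_swap_right {N : ℕ} {F : (Fin N → ℂ) → ℂ} (hF : ContDiff ℂ ⊤ F) (i p q : Fin N)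
    (x : Fin N → ℂ) : D3 F i p q x = D3 F i q p x := by
  unfold D3
  rw [pd_comm hF]

/-- The vector of signed maximal minors is orthogonal to the rows of `M`. -/
theorem Matrix.sum_minors_mul_row_eq_zero {R : Type*} [CommRing R] {n : ℕ}
    (M : Matrix (Fin n) (Fin (n + 1)) R) (i : Fin n) :
    ∑ k : Fin (n + 1), (-1 : R) ^ (k : ℕ) *
      (Matrix.of fun a b : Fin n => M a (k.succAbove b)).det * M i k = 0 := by
  have h : (Matrix.of (Fin.cons (M i) M : Fin (n + 1) → Fin (n + 1) → R)).det = 0 :=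
    Matrix.det_zero_of_row_eq (Fin.succ_ne_zero i).symm rfl
  rw [Matrix.det_succ_row_zero] at h
  rw [← h]
  refine Finset.sum_congr rfl fun k _ => ?_
  rw [mul_right_comm]
  rfl

/-- A matrix of full row rank has trivial left kernel. -/
theorem Matrix.eq_zero_of_vecMul_eq_zero_of_rank_eq {K : Type*} [Field K] {n m : ℕ}
    (M : Matrix (Fin n) (Fin m) K) (hM : M.rank = n) (w : Fin n → K)
    (hw : Matrix.vecMul w M = 0) : w = 0 := by
  have hli : LinearIndependent K M.row := by
    rw [linearIndependent_iff_card_eq_finrank_span, Fintype.card_fin]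
    rw [Matrix.rank_eq_finrank_span_row] at hM
    exact hM.symm
  exact Matrix.vecMul_injective_iff.mpr hli (hw.trans (Matrix.zero_vecMul M).symm)

theorem sum_Acoef_mul_D3_eq_zero {n : ℕ} (F : (Fin (n + 1) → ℂ) → ℂ) (i₀ : Fin (n + 1))
    (x : Fin (n + 1) → ℂ) {p : Fin (n + 1)} (hp : p ≠ i₀) :
    ∑ k, Acoef F i₀ x k * D3 F i₀ p k x = 0 := by
  obtain ⟨i, rfl⟩ := Fin.exists_succAbove_eq hp
  exact Matrix.sum_minors_mul_row_eq_zero (Pmat F i₀ x) i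

theorem Bmat_symm {n : ℕ} {F : (Fin (n + 1) → ℂ) → ℂ} (hF : ContDiff ℂ ⊤ F)
    (i₀ : Fin (n + 1)) (x : Fin (n + 1) → ℂ) (r t : Fin (n + 1)) :
    Bmat F i₀ x r t = Bmat F i₀ x t r := by
  simp only [Bmat, Matrix.of_apply, D3_swap_right hF _ r t]

theorem Bmat_apply_base_eq_zero {n : ℕ} {F : (Fin (n + 1) → ℂ) → ℂ} (hF : ContDiff ℂ ⊤ F)
    {i₀ : Fin (n + 1)} (x : Fin (n + 1) → ℂ) {p : Fin (n + 1)} (hp : p ≠ i₀) :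
    Bmat F i₀ x p i₀ = 0 := by
  rw [← sum_Acoef_mul_D3_eq_zero F i₀ x hp, Bmat, Matrix.of_apply]
  refine Finset.sum_congr rfl fun k _ => ?_
  rw [D3_swap_right hF, D3_swap_left hF, D3_swap_right hF]

theorem Bmat_eq_sum_smul {n : ℕ} (F : (Fin (n + 1) → ℂ) → ℂ) (i₀ : Fin (n + 1))
    (x : Fin (n + 1) → ℂ) : Bmat F i₀ x = ∑ k, Acoef F i₀ x k • Fmat F k x := by
  ext i j
  simp [Bmat, Fmat, Matrix.sum_apply]

theorem commute_Bmat_Fmat {n : ℕ} {F : (Fin (n + 1) → ℂ) → ℂ} {x : Fin (n + 1) → ℂ}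
    (hcomm : ∀ i j, Commute (Fmat F i x) (Fmat F j x)) (i₀ t : Fin (n + 1)) :
    Commute (Bmat F i₀ x) (Fmat F t x) := by
  rw [Bmat_eq_sum_smul]
  exact Commute.sum_left _ _ _ fun k _ => (hcomm k t).smul_left _

/-- `B` acts as the scalar `B_{i₀ i₀}` after multiplication by `F_{i₀}`. -/
theorem Fmat_mul_Bmat {n : ℕ} {F : (Fin (n + 1) → ℂ) → ℂ} (hF : ContDiff ℂ ⊤ F)
    {x : Fin (n + 1) → ℂ} (hcomm : ∀ i j, Commute (Fmat F i x) (Fmat F j x))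
    (i₀ : Fin (n + 1)) :
    Fmat F i₀ x * Bmat F i₀ x = Bmat F i₀ x i₀ i₀ • Fmat F i₀ x := by
  rw [← (commute_Bmat_Fmat hcomm i₀ i₀).eq]
  ext p t
  calc (Bmat F i₀ x * Fmat F i₀ x) p t = (Bmat F i₀ x * Fmat F t x) p i₀ := by
        simp only [Matrix.mul_apply]
        refine Finset.sum_congr rfl fun s _ => ?_
        simp only [Fmat, Matrix.of_apply]
        rw [D3_swap_right hF, D3_swap_left hF, D3_swap_right hF]
    _ = (Fmat F t x * Bmat F i₀ x) p i₀ := by rw [(commute_Bmat_Fmat hcomm i₀ t).eq]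
    _ = Fmat F t x p i₀ * Bmat F i₀ x i₀ i₀ := by
        rw [Matrix.mul_apply]
        refine Finset.sum_eq_single _ (fun s _ hs => ?_) (by simp)
        rw [Bmat_apply_base_eq_zero hF x hs, mul_zero]
    _ = (Bmat F i₀ x i₀ i₀ • Fmat F i₀ x) p t := by
        simp only [Fmat, Matrix.smul_apply, Matrix.of_apply, smul_eq_mul]
        rw [mul_comm, D3_swap_right hF, D3_swap_left hF, D3_swap_right hF]

theorem eq_zero_of_Fmat_mulVec_eq_zero {n : ℕ} {F : (Fin (n + 1) → ℂ) → ℂ}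
    (hF : ContDiff ℂ ⊤ F) {i₀ : Fin (n + 1)} {x : Fin (n + 1) → ℂ}
    (hrank : (Pmat F i₀ x).rank = n) {v : Fin (n + 1) → ℂ} (hv₀ : v i₀ = 0)
    (hv : Matrix.mulVec (Fmat F i₀ x) v = 0) : v = 0 := by
  have hw : (fun i => v (i₀.succAbove i)) = 0 := by
    refine Matrix.eq_zero_of_vecMul_eq_zero_of_rank_eq _ hrank _ ?_
    ext p
    have hp := congrFun hv p
    simp only [Matrix.mulVec, dotProduct, Fin.sum_univ_succAbove _ i₀, hv₀, mul_zero,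
      zero_add] at hp
    rw [← hp, Matrix.vecMul, dotProduct]
    refine Finset.sum_congr rfl fun i _ => ?_
    simp only [Pmat, Fmat, Matrix.of_apply]
    rw [mul_comm, D3_swap_right hF]
  ext p
  rcases eq_or_ne p i₀ with rfl | hp
  · exact hv₀
  · obtain ⟨i, rfl⟩ := Fin.exists_succAbove_eq hp
    exact congrFun hw i

/-- `B` is a scalar matrix. -/
theorem Bmat_eq_smul_one {n : ℕ} {F : (Fin (n + 1) → ℂ) → ℂ} (hF : ContDiff ℂ ⊤ F)
    {i₀ : Fin (n + 1)} {x : Fin (n + 1) → ℂ}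
    (hcomm : ∀ i j, Commute (Fmat F i x) (Fmat F j x)) (hrank : (Pmat F i₀ x).rank = n) :
    Bmat F i₀ x = Bmat F i₀ x i₀ i₀ • (1 : Matrix (Fin (n + 1)) (Fin (n + 1)) ℂ) := by
  rw [← sub_eq_zero]
  set C := Bmat F i₀ x - Bmat F i₀ x i₀ i₀ • (1 : Matrix (Fin (n + 1)) (Fin (n + 1)) ℂ) with hC
  have hmul : Fmat F i₀ x * C = 0 := by
    rw [hC, mul_sub, Fmat_mul_Bmat hF hcomm, mul_smul_comm, mul_one, sub_self]
  ext r t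
  refine congrFun (eq_zero_of_Fmat_mulVec_eq_zero hF hrank (v := fun s => C s t) ?_ ?_) r
  · rcases eq_or_ne t i₀ with rfl | ht
    · simp [hC]
    · simp [hC, Bmat_symm hF i₀ x i₀ t, Bmat_apply_base_eq_zero hF x ht,
        Matrix.one_apply_ne ht.symm]
  · ext p
    exact congrFun (congrFun hmul p) t

/-- `B` is diagonal. -/
theorem stmt11 {n : ℕ} (F : (Fin (n + 1) → ℂ) → ℂ) (hF : ContDiff ℂ ⊤ F)
    (hcomm : ∀ x, ∀ i j : Fin (n + 1), Fmat F i x * Fmat F j x = Fmat F j x * Fmat F i x)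
    (i₀ : Fin (n + 1)) (x : Fin (n + 1) → ℂ)
    (hrank : (Pmat F i₀ x).rank = n) :
    ∀ r t : Fin (n + 1), r ≠ t → Bmat F i₀ x r t = 0 := by
  intro r t hrt
  rw [Bmat_eq_smul_one hF (hcomm x) hrank]
  simp [Matrix.one_apply_ne hrt]
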